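/- arXiv:1303.3101 — 2 statements merged into one kernel-verified Lean document; each statement's English description precedes it below -/
import Mathlib

section
/- For every integer k ≥ 3, the sequence n ↦ d_k(n)/C(n,k), where d_k(n) is the supremum over all digraphs D on n vertices of the number of k-element vertex subsets of D inducing a copy of the directed star S⃗_k, converges as n → ∞ to α_k = sup_{x ∈ [0,1)} k·x·(1−x)^{k−1}/(1−x^k). -/
/-- The number of `k`-element vertex subsets of the digraph `D` (given by its arc
relation) that induce a copy of the directed star `S⃗ₖ`. -/
noncomputable def starCount (k : ℕ) {V : Type} [Fintype V] (D : V → V → Prop) : ℕ :=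
  {S : Finset V | S.card = k ∧
    ∃ v ∈ S, ∀ u ∈ S, ∀ w ∈ S, (D u w ↔ (u = v ∧ w ≠ v))}.ncard

/-- `d_k(n)`: the supremum over digraphs on `n` vertices of the number of
`k`-subsets inducing a copy of `S⃗ₖ`. -/
noncomputable def starExtremal (k n : ℕ) : ℕ :=
  sSup {m : ℕ | ∃ D : Fin n → Fin n → Prop, starCount k D = m}

/-- `α_k = sup_{x ∈ [0,1)} k·x·(1−x)^{k−1}/(1−x^k)`. -/
noncomputable def alphaStar (k : ℕ) : ℝ :=
  sSup ((fun x : ℝ => (k : ℝ) * x * (1 - x) ^ (k - 1) / (1 - x ^ k)) '' Set.Ico 0 1)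

open scoped Classical in
/-- indicator of being a star -/
noncomputable def chi {V : Type} (k : ℕ) (D : V → V → Prop) (S : Finset V) : ℕ :=
  if S.card = k ∧ ∃ v ∈ S, ∀ u ∈ S, ∀ w ∈ S, (D u w ↔ (u = v ∧ w ≠ v)) then 1 else 0

lemma ncard_eq_sum_ite {α : Type} [Fintype α] (p : α → Prop) [DecidablePred p] :
    {a | p a}.ncard = ∑ a, if p a then 1 else 0 := by
  rw [← Finset.card_filter, Set.ncard_eq_toFinset_card']
  congr 1
  ext a
  simp

lemma starCount_eq_sum {V : Type} [Fintype V] (k : ℕ) (D : V → V → Prop) :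
    starCount k D = ∑ S : Finset V, chi k D S := by
  classical
  unfold starCount
  rw [ncard_eq_sum_ite]
  unfold chi
  congr!

lemma chi_le_one {V : Type} (k : ℕ) (D : V → V → Prop) (S : Finset V) : chi k D S ≤ 1 := by
  unfold chi; split_ifs <;> simp

lemma chi_mono {V W : Type} {k : ℕ} {D : V → V → Prop} {E : W → W → Prop} {S : Finset V}
    {T : Finset W}
    (h : (S.card = k ∧ ∃ v ∈ S, ∀ u ∈ S, ∀ w ∈ S, (D u w ↔ (u = v ∧ w ≠ v))) →
      (T.card = k ∧ ∃ v ∈ T, ∀ u ∈ T, ∀ w ∈ T, (E u w ↔ (u = v ∧ w ≠ v)))) :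
    chi k D S ≤ chi k E T := by
  unfold chi
  split_ifs <;> simp_all

/-- pull-back of stars -/
lemma chi_pull {V W : Type} {k : ℕ} {D : V → V → Prop} {S : Finset V} {T : Finset W}
    (f : W → V) (hc : T.card = S.card) (hf : ∀ p ∈ T, f p ∈ S)
    (hv : ∀ v ∈ S, S.card = k → (∀ u ∈ S, ∀ w ∈ S, (D u w ↔ (u = v ∧ w ≠ v))) →
      ∃ v' ∈ T, ∀ p ∈ T, f p = v ↔ p = v') :
    chi k D S ≤ chi k (fun a b => D (f a) (f b)) T := by
  apply chi_mono
  rintro ⟨h1, v, hvS, h⟩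
  obtain ⟨v', hv'T, h'⟩ := hv v hvS h1 h
  refine ⟨by omega, v', hv'T, ?_⟩
  intro a ha b hb
  rw [h _ (hf a ha) _ (hf b hb), h' a ha, Ne, h' b hb]

/-- replace `u` by a clone of `w` -/
def cl {V : Type} [DecidableEq V] (D : V → V → Prop) (u w : V) : V → V → Prop :=
  fun a b => D (if a = u then w else a) (if b = u then w else b)

lemma chi_cl_same {V : Type} [DecidableEq V] {k : ℕ} {D : V → V → Prop} {u w : V}
    (S : Finset V) (_hk : 2 ≤ k) (huw : ¬ D u w) (hwu : ¬ D w u) (hne : u ≠ w)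
    (hS : u ∉ S ∨ w ∈ S) :
    chi k D S ≤ chi k (cl D u w) S := by
  apply chi_pull (fun a => if a = u then w else a) rfl
  · intro p hp
    split_ifs with h
    · subst h; tauto
    · exact hp
  · intro v hv hc h
    refine ⟨v, hv, ?_⟩
    intro p hp
    split_ifs with hpu
    · subst hpu
      have hw : w ∈ S := by tauto
      have h1 := h p hp w hw
      have h2 := h w hw p hp
      grind
    · rfl

lemma chi_cl_swap {V : Type} [DecidableEq V] {k : ℕ} {D : V → V → Prop} {u w : V}
    (S : Finset V) (hne : u ≠ w) (hu : u ∈ S) (hw : w ∉ S) :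
    chi k D (S.map (Equiv.swap u w).toEmbedding) ≤ chi k (cl D u w) S := by
  have key : ∀ p ∈ S, (if p = u then w else p) = Equiv.swap u w p := by
    intro p hp
    split_ifs with h
    · subst h; simp
    · rw [Equiv.swap_apply_of_ne_of_ne h (by rintro rfl; exact hw hp)]
  apply chi_pull (fun a => if a = u then w else a) (by simp)
  · intro p hp
    rw [key p hp]
    exact Finset.mem_map_of_mem _ hp
  · intro v hv _ _
    obtain ⟨v', hv', rfl⟩ := Finset.mem_map.1 hv
    refine ⟨v', hv', fun p hp => ?_⟩
    rw [key p hp]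
    simp

lemma map_swap_eq {V : Type} [DecidableEq V] {u w : V} (S : Finset V) (h : u ∈ S ↔ w ∈ S) :
    S.map (Equiv.swap u w).toEmbedding = S := by
  ext p
  rw [Finset.mem_map_equiv, Equiv.symm_swap, Equiv.swap_apply_def]
  split_ifs with h1 h2
  · subst h1; exact h.symm
  · subst h2; exact h
  · rfl

lemma chi_pair {V : Type} [DecidableEq V] {k : ℕ} {D : V → V → Prop} {u w : V}
    (S : Finset V) (hk : 2 ≤ k) (huw : ¬ D u w) (hwu : ¬ D w u) (hne : u ≠ w) :
    chi k D S + chi k D (S.map (Equiv.swap u w).toEmbedding) ≤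
      chi k (cl D u w) S + chi k (cl D w u) S := by
  by_cases hu : u ∈ S <;> by_cases hw : w ∈ S
  · rw [map_swap_eq S (by tauto)]
    exact add_le_add (chi_cl_same S hk huw hwu hne (by tauto))
      (chi_cl_same S hk hwu huw hne.symm (by tauto))
  · rw [add_comm]
    exact add_le_add (chi_cl_swap S hne hu hw) (chi_cl_same S hk hwu huw hne.symm (by tauto))
  · rw [Equiv.swap_comm]
    exact add_le_add (chi_cl_same S hk huw hwu hne (by tauto)) (chi_cl_swap S hne.symm hw hu)
  · rw [map_swap_eq S (by tauto)]
    exact add_le_add (chi_cl_same S hk huw hwu hne (by tauto))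
      (chi_cl_same S hk hwu huw hne.symm (by tauto))

lemma starCount_cl {V : Type} [Fintype V] [DecidableEq V] {k : ℕ} {D : V → V → Prop} {u w : V}
    (hk : 2 ≤ k) (huw : ¬ D u w) (hwu : ¬ D w u) (hne : u ≠ w) :
    2 * starCount k D ≤ starCount k (cl D u w) + starCount k (cl D w u) := by
  have h1 : ∑ S : Finset V, chi k D (S.map (Equiv.swap u w).toEmbedding) = starCount k D := by
    rw [starCount_eq_sum]
    exact Equiv.sum_comp (Equiv.finsetCongr (Equiv.swap u w)) (fun S => chi k D S)
  rw [two_mul]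
  nth_rewrite 2 [← h1]
  rw [starCount_eq_sum, starCount_eq_sum, starCount_eq_sum, ← Finset.sum_add_distrib,
    ← Finset.sum_add_distrib]
  exact Finset.sum_le_sum fun S _ => chi_pair S hk huw hwu hne

/-- being clones -/
def Cln {V : Type} (D : V → V → Prop) (p q : V) : Prop :=
  ∀ z, (D p z ↔ D q z) ∧ (D z p ↔ D z q)

open scoped Classical in
/-- number of clones -/
noncomputable def ccl {V : Type} [Fintype V] (D : V → V → Prop) (p : V) : ℕ :=
  ∑ q : V, if Cln D p q then 1 else 0

/-- number of clone pairs -/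
noncomputable def Phi {V : Type} [Fintype V] (D : V → V → Prop) : ℕ :=
  ∑ p : V, ccl D p

lemma Cln_cl {V : Type} [DecidableEq V] {D : V → V → Prop} {u w p q : V}
    (h : Cln D (if p = u then w else p) (if q = u then w else q)) : Cln (cl D u w) p q :=
  fun z => h (if z = u then w else z)

lemma Cln_symm {V : Type} {D : V → V → Prop} {p q : V} : Cln D p q ↔ Cln D q p := by
  unfold Cln
  constructor <;> exact fun h z => ⟨(h z).1.symm, (h z).2.symm⟩

lemma Phi_lt {V : Type} [Fintype V] [DecidableEq V] {D : V → V → Prop} {u w : V}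
    (hn : ¬ Cln D u w) (hle : ccl D u ≤ ccl D w) :
    Phi D < Phi (cl D u w) := by
  classical
  have hrefl : ∀ p, Cln D p p := fun p z => ⟨Iff.rfl, Iff.rfl⟩
  have hne : u ≠ w := by rintro rfl; exact hn (hrefl _)
  let F : V → V → ℕ := fun p q => if Cln D p q then 1 else 0
  let φ : V → V := fun p => if p = u then w else p
  have hφu : φ u = w := by simp [φ]
  have hφ : ∀ p, p ≠ u → φ p = p := by intro p hp; simp [φ, hp]
  have h1 : ∑ p, ∑ q, F (φ p) (φ q) ≤ Phi (cl D u w) := by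
    unfold Phi ccl
    refine Finset.sum_le_sum fun p _ => Finset.sum_le_sum fun q _ => ?_
    by_cases h : Cln D (φ p) (φ q)
    · have := Cln_cl h
      simp [F, h, this]
    · simp [F, h]
  refine lt_of_lt_of_le ?_ h1
  have hFs : ∀ p q, F p q = F q p := by intro p q; simp [F, Cln_symm (p := p)]
  have e : ∀ G : V → V → ℕ, (∀ p q, G p q = G q p) → ∑ p, ∑ q, G p q =
      G u u + 2 * ∑ q ∈ Finset.univ.erase u, G u q +
        ∑ p ∈ Finset.univ.erase u, ∑ q ∈ Finset.univ.erase u, G p q := by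
    intro G hG
    rw [← Finset.add_sum_erase _ _ (Finset.mem_univ u)]
    rw [← Finset.add_sum_erase _ (fun q => G u q) (Finset.mem_univ u)]
    have : ∀ p, ∑ q, G p q = G u p + ∑ q ∈ Finset.univ.erase u, G p q := by
      intro p
      rw [← Finset.add_sum_erase _ _ (Finset.mem_univ u), hG]
    rw [Finset.sum_congr rfl (fun p _ => this p), Finset.sum_add_distrib]
    ring
  have hP : Phi D = ∑ p, ∑ q, F p q := rfl
  rw [hP, e F hFs, e (fun p q => F (φ p) (φ q)) (fun p q => hFs _ _)]
  have h2 : ∑ p ∈ Finset.univ.erase u, ∑ q ∈ Finset.univ.erase u, F (φ p) (φ q) =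
      ∑ p ∈ Finset.univ.erase u, ∑ q ∈ Finset.univ.erase u, F p q := by
    refine Finset.sum_congr rfl fun p hp => Finset.sum_congr rfl fun q hq => ?_
    rw [hφ p (Finset.ne_of_mem_erase hp), hφ q (Finset.ne_of_mem_erase hq)]
  have h3 : ∑ q ∈ Finset.univ.erase u, F (φ u) (φ q) = ∑ q ∈ Finset.univ.erase u, F w q := by
    refine Finset.sum_congr rfl fun q hq => ?_
    rw [hφ q (Finset.ne_of_mem_erase hq), hφu]
  have h4 : ccl D u = F u u + ∑ q ∈ Finset.univ.erase u, F u q :=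
    (Finset.add_sum_erase _ (F u) (Finset.mem_univ u)).symm
  have h5 : ccl D w = F w u + ∑ q ∈ Finset.univ.erase u, F w q :=
    (Finset.add_sum_erase _ (F w) (Finset.mem_univ u)).symm
  have h6 : F u u = 1 := by simp [F, hrefl]
  have h7 : F w u = 0 := by simp [F, Cln_symm (p := w), hn]
  have h8 : F (φ u) (φ u) = 1 := by simp [F, hrefl]
  rw [h2, h3, h8]
  omega

lemma exists_extremal {V : Type} [Fintype V] (k : ℕ) (hk : 2 ≤ k) (D₀ : V → V → Prop) :
    ∃ D : V → V → Prop, starCount k D₀ ≤ starCount k D ∧ (∀ v, ¬ D v v) ∧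
      ∀ u w, ¬ D u w → ¬ D w u → Cln D u w := by
  classical
  let X : Set (V → V → Prop) := {D | ∀ v, ¬ D v v}
  have hX : X.Finite := Set.toFinite _
  obtain ⟨D1, hD1, hmax1⟩ := Set.exists_max_image X (fun D => starCount k D) hX
    ⟨fun _ _ => False, by simp [X]⟩
  let Y : Set (V → V → Prop) := {D | (∀ v, ¬ D v v) ∧ starCount k D = starCount k D1}
  obtain ⟨D, ⟨hDi, hDe⟩, hmax⟩ := Set.exists_max_image Y Phi (Set.toFinite _)
    ⟨D1, hD1, rfl⟩
  refine ⟨D, ?_, hDi, ?_⟩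
  · rw [hDe]
    refine le_trans ?_ (hmax1 (fun a b => D₀ a b ∧ a ≠ b) (by simp [X]))
    rw [starCount_eq_sum, starCount_eq_sum]
    refine Finset.sum_le_sum fun S _ => chi_mono ?_
    rintro ⟨h1, v, hv, h⟩
    refine ⟨h1, v, hv, fun a ha b hb => ?_⟩
    rw [h a ha b hb]
    grind
  · have main : ∀ u w, ¬ D u w → ¬ D w u → ccl D u ≤ ccl D w → Cln D u w := by
      intro u w h1 h2 hle
      by_contra hn
      have hne : u ≠ w := by rintro rfl; exact hn (fun z => ⟨Iff.rfl, Iff.rfl⟩)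
      have hs := starCount_cl hk h1 h2 hne
      have ha := hmax1 (cl D u w) (fun v => hDi _)
      have hb := hmax1 (cl D w u) (fun v => hDi _)
      have := hmax (cl D u w) ⟨fun v => hDi _, by omega⟩
      have := Phi_lt hn hle
      omega
    intro u w h1 h2
    rcases le_total (ccl D u) (ccl D w) with h | h
    · exact main u w h1 h2 h
    · exact Cln_symm.1 (main w u h2 h1 h)

lemma alpha_bdd (k : ℕ) (hk : 3 ≤ k) :
    BddAbove ((fun x : ℝ => (k : ℝ) * x * (1 - x) ^ (k - 1) / (1 - x ^ k)) '' Set.Ico 0 1) := by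
  refine ⟨k, ?_⟩
  rintro _ ⟨x, ⟨h0, h1⟩, rfl⟩
  have hxk : x ^ k ≤ x := pow_le_of_le_one h0 h1.le (by omega)
  have h2 : (1 - x) ^ (k - 1) ≤ 1 - x := pow_le_of_le_one (by linarith) (by linarith) (by omega)
  have h3 : 0 ≤ (1 - x) ^ (k - 1) := pow_nonneg (by linarith) _
  show (k : ℝ) * x * (1 - x) ^ (k - 1) / (1 - x ^ k) ≤ k
  rw [div_le_iff₀ (by linarith), mul_assoc]
  apply mul_le_mul_of_nonneg_left _ (by positivity)
  nlinarith

lemma alpha_ge (k : ℕ) (hk : 3 ≤ k) (y : ℝ) (h0 : 0 ≤ y) (h1 : y < 1) :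
    k * y * (1 - y) ^ (k - 1) ≤ alphaStar k * (1 - y ^ k) := by
  have hyk : y ^ k ≤ y := pow_le_of_le_one h0 h1.le (by omega)
  rw [← div_le_iff₀ (by linarith)]
  exact le_csSup (alpha_bdd k hk) ⟨y, ⟨h0, h1⟩, rfl⟩

lemma alpha_nonneg (k : ℕ) (hk : 3 ≤ k) : 0 ≤ alphaStar k := by
  have := alpha_ge k hk 0 le_rfl one_pos
  have h : k ≠ 0 := by omega
  simpa [h] using this

lemma alpha_step (k : ℕ) (hk : 3 ≤ k) (s a : ℝ) (hs : 0 ≤ s) (ha : 0 ≤ a) :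
    alphaStar k / k * s ^ k + s * a ^ (k - 1) ≤ alphaStar k / k * (s + a) ^ k := by
  have hk0 : (0 : ℝ) < k := by exact_mod_cast (by omega : 0 < k)
  rcases ha.eq_or_lt with rfl | ha
  · rw [zero_pow (by omega)]; simp
  have ht : 0 < s + a := by linarith
  have h := alpha_ge k hk (s / (s + a)) (by positivity) (by rw [div_lt_one ht]; linarith)
  have e : 1 - s / (s + a) = a / (s + a) := by field_simp; ring
  obtain ⟨m, rfl⟩ : ∃ m, k = m + 1 := ⟨k - 1, by omega⟩
  rw [e] at h
  simp only [Nat.add_sub_cancel] at h ⊢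
  have h2 := mul_le_mul_of_nonneg_right h (pow_nonneg ht.le (m + 1))
  have e1 : ((m + 1 : ℕ) : ℝ) * (s / (s + a)) * (a / (s + a)) ^ m * (s + a) ^ (m + 1) =
      ((m + 1 : ℕ) : ℝ) * (s * a ^ m) := by
    rw [div_pow, pow_succ (s + a)]; field_simp
  have e2 : alphaStar (m + 1) * (1 - (s / (s + a)) ^ (m + 1)) * (s + a) ^ (m + 1) =
      alphaStar (m + 1) * (s + a) ^ (m + 1) - alphaStar (m + 1) * s ^ (m + 1) := by
    rw [div_pow]; field_simp
  rw [e1, e2] at h2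
  rw [div_mul_eq_mul_div, div_mul_eq_mul_div, ← sub_nonneg]
  have : (alphaStar (m + 1) * (s + a) ^ (m + 1) / ((m + 1 : ℕ) : ℝ)) -
      (alphaStar (m + 1) * s ^ (m + 1) / ((m + 1 : ℕ) : ℝ) + s * a ^ m) =
      (alphaStar (m + 1) * (s + a) ^ (m + 1) - alphaStar (m + 1) * s ^ (m + 1) -
        ((m + 1 : ℕ) : ℝ) * (s * a ^ m)) / ((m + 1 : ℕ) : ℝ) := by
    field_simp
    ring
  rw [this]
  apply div_nonneg _ hk0.le
  linarith

open scoped Classical in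
lemma class_bound {ι : Type} (k : ℕ) (hk : 3 ≤ k) (R : ι → ι → Prop)
    (hR : ∀ i j, R i j → ¬ R j i) (x : ι → ℝ) (hx : ∀ i, 0 ≤ x i) (P : Finset ι) :
    ∑ i ∈ P, ∑ j ∈ P, (if R i j then x i * x j ^ (k - 1) else 0) ≤
      alphaStar k / k * (∑ i ∈ P, x i) ^ k := by
  induction P using Finset.induction_on_max_value x with
  | empty => simp [show k ≠ 0 by omega]
  | insert a s has hmax ih =>
    set G : ι → ι → ℝ := fun i j => if R i j then x i * x j ^ (k - 1) else 0 with hG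
    have haa : G a a = 0 := by
      have : ¬ R a a := fun h => hR _ _ h h
      simp [hG, this]
    have e : ∑ i ∈ insert a s, ∑ j ∈ insert a s, G i j =
        ∑ i ∈ s, ∑ j ∈ s, G i j + ∑ j ∈ s, (G a j + G j a) := by
      rw [Finset.sum_insert has, Finset.sum_insert has, haa]
      have : ∀ i ∈ s, ∑ j ∈ insert a s, G i j = G i a + ∑ j ∈ s, G i j := fun i _ =>
        Finset.sum_insert has
      rw [Finset.sum_congr rfl this, Finset.sum_add_distrib, Finset.sum_add_distrib]
      ring
    have h1 : ∑ j ∈ s, (G a j + G j a) ≤ ∑ j ∈ s, x j * x a ^ (k - 1) := by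
      refine Finset.sum_le_sum fun j hj => ?_
      have hja := hmax j hj
      have hle : x a * x j ^ (k - 1) ≤ x j * x a ^ (k - 1) := by
        obtain ⟨m, hm⟩ : ∃ m, k - 1 = m + 1 := ⟨k - 2, by omega⟩
        rw [hm, pow_succ, pow_succ]
        have := pow_le_pow_left₀ (hx j) hja m
        have h3 := mul_le_mul_of_nonneg_left this (mul_nonneg (hx a) (hx j))
        nlinarith
      have hn : 0 ≤ x j * x a ^ (k - 1) := mul_nonneg (hx j) (pow_nonneg (hx a) _)
      by_cases h1 : R a j
      · have h2 := hR _ _ h1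
        simp [hG, h1, h2, hle]
      · by_cases h2 : R j a <;> simp [hG, h1, h2, hn]
    rw [← Finset.sum_mul] at h1
    have h2 := alpha_step k hk (∑ j ∈ s, x j) (x a) (Finset.sum_nonneg fun i _ => hx i) (hx a)
    rw [e, Finset.sum_insert has, add_comm (x a)]
    linarith

lemma starCount_le {V : Type} [Fintype V] (k : ℕ) (hk : 3 ≤ k) (D₀ : V → V → Prop) :
    (starCount k D₀ : ℝ) ≤ alphaStar k * (Fintype.card V : ℝ) ^ k / (k.factorial : ℝ) := by
  classical
  obtain ⟨D, hle, hirr, hcl⟩ := exists_extremal k (by omega) D₀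
  have hle' : (starCount k D₀ : ℝ) ≤ starCount k D := by exact_mod_cast hle
  refine hle'.trans ?_
  let st : Setoid V := ⟨Cln D, ⟨fun p z => ⟨Iff.rfl, Iff.rfl⟩, fun h => Cln_symm.1 h,
    fun h1 h2 z => ⟨(h1 z).1.trans (h2 z).1, (h1 z).2.trans (h2 z).2⟩⟩⟩
  let Q := Quotient st
  let π : V → Q := fun v => Quotient.mk st v
  have hπ : ∀ {u w}, π u = π w ↔ Cln D u w := fun {u w} => Quotient.eq (r := st)
  let R : Q → Q → Prop := fun q r => ∃ u w, π u = q ∧ π w = r ∧ D u w ∧ ¬ D w u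
  have hR : ∀ i j, R i j → ¬ R j i := by
    rintro _ _ ⟨u, w, rfl, rfl, h1, h2⟩ ⟨w', u', hw, hu, h3, h4⟩
    rw [hπ] at hw hu
    exact h2 ((hu w).2.1 ((hw u').1.1 h3))
  let fib : Q → Finset V := fun q => Finset.univ.filter fun v => π v = q
  let A : Q × Q → Finset (Finset V) := fun z =>
    (fib z.1 ×ˢ (fib z.2).powersetCard (k - 1)).image fun y => insert y.1 y.2
  have hcount : starCount k D ≤
      ∑ z ∈ (Finset.univ : Finset (Q × Q)).filter (fun z => R z.1 z.2),
        (fib z.1).card * ((fib z.2).card).choose (k - 1) := by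
    have hsub : {S : Finset V | S.card = k ∧
        ∃ v ∈ S, ∀ u ∈ S, ∀ w ∈ S, (D u w ↔ (u = v ∧ w ≠ v))} ⊆
        (((Finset.univ : Finset (Q × Q)).filter (fun z => R z.1 z.2)).biUnion A :
          Finset (Finset V)) := by
      rintro S ⟨hc, v, hv, h⟩
      have hcT : (S.erase v).card = k - 1 := by rw [Finset.card_erase_of_mem hv, hc]
      obtain ⟨w, hw⟩ : (S.erase v).Nonempty := Finset.card_pos.1 (by omega)
      have hwS := Finset.mem_of_mem_erase hw
      have hwv := Finset.ne_of_mem_erase hw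
      simp only [Finset.coe_biUnion, Set.mem_iUnion, Finset.mem_coe, Finset.mem_filter,
        Finset.mem_univ, true_and, A, Finset.mem_image, Finset.mem_product,
        Finset.mem_powersetCard, exists_prop]
      refine ⟨(π v, π w), ⟨v, w, rfl, rfl, ?_, ?_⟩, (v, S.erase v), ⟨?_, ?_, hcT⟩, ?_⟩
      · rw [h v hv w hwS]; exact ⟨rfl, hwv⟩
      · rw [h w hwS v hv]; tauto
      · simp [fib]
      · intro p hp
        have hpS := Finset.mem_of_mem_erase hp
        have hpv := Finset.ne_of_mem_erase hp
        simp only [fib, Finset.mem_filter, Finset.mem_univ, true_and]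
        rw [hπ]
        apply hcl
        · rw [h p hpS w hwS]; tauto
        · rw [h w hwS p hpS]; tauto
      · exact Finset.insert_erase hv
    unfold starCount
    refine (Set.ncard_le_ncard hsub (Finset.finite_toSet _)).trans ?_
    rw [Set.ncard_coe_finset]
    refine Finset.card_biUnion_le.trans (Finset.sum_le_sum fun z _ => ?_)
    refine Finset.card_image_le.trans ?_
    rw [Finset.card_product, Finset.card_powersetCard]
  have hkf : (k.factorial : ℝ) = k * (k - 1).factorial := by
    obtain ⟨m, rfl⟩ : ∃ m, k = m + 1 := ⟨k - 1, by omega⟩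
    rw [Nat.factorial_succ]; push_cast; simp
  have hf : (0 : ℝ) < (k - 1).factorial := by exact_mod_cast Nat.factorial_pos _
  have hk0 : (0 : ℝ) < k := by exact_mod_cast (by omega : 0 < k)
  have hsum : ∑ q : Q, ((fib q).card : ℝ) = Fintype.card V := by
    have := Finset.card_eq_sum_card_fiberwise (f := π) (s := Finset.univ) (t := Finset.univ)
      (fun _ _ => Finset.mem_coe.2 (Finset.mem_univ _))
    rw [Finset.card_univ] at this
    rw [this]; push_cast; rfl
  have hb := class_bound k hk R hR (fun q => ((fib q).card : ℝ)) (fun q => by positivity)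
    Finset.univ
  rw [hsum] at hb
  have h1 : (starCount k D : ℝ) ≤ (∑ i : Q, ∑ j : Q, (if R i j then
      ((fib i).card : ℝ) * ((fib j).card : ℝ) ^ (k - 1) else 0)) / (k - 1).factorial := by
    have : (starCount k D : ℝ) ≤ ((∑ z ∈ (Finset.univ : Finset (Q × Q)).filter
      (fun z => R z.1 z.2), (fib z.1).card * ((fib z.2).card).choose (k - 1) : ℕ) : ℝ) := by
      exact_mod_cast hcount
    refine this.trans ?_
    rw [← Finset.univ_product_univ, Finset.sum_filter, Finset.sum_product, Finset.sum_div]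
    push_cast
    refine Finset.sum_le_sum fun i _ => ?_
    rw [Finset.sum_div]
    refine Finset.sum_le_sum fun j _ => ?_
    by_cases h : R i j
    · simp only [h, if_true]
      rw [mul_div_assoc]
      exact mul_le_mul_of_nonneg_left (Nat.choose_le_pow_div _ _) (by positivity)
    · simp [h]
  refine h1.trans ?_
  rw [hkf, div_le_iff₀ hf]
  refine le_trans (le_of_eq ?_) (hb.trans (le_of_eq ?_))
  · congr!
  · field_simp

lemma starExtremal_bdd (k n : ℕ) :
    BddAbove {m : ℕ | ∃ D : Fin n → Fin n → Prop, starCount k D = m} := by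
  apply Set.Finite.bddAbove
  exact Set.finite_range (fun D : Fin n → Fin n → Prop => starCount k D)

lemma starExtremal_mem (k n : ℕ) :
    ∃ D : Fin n → Fin n → Prop, starCount k D = starExtremal k n :=
  Nat.sSup_mem (s := {m : ℕ | ∃ D : Fin n → Fin n → Prop, starCount k D = m})
    ⟨_, fun _ _ => False, rfl⟩ (starExtremal_bdd k n)

lemma starExtremal_le (k : ℕ) (hk : 3 ≤ k) (n : ℕ) :
    (starExtremal k n : ℝ) ≤ alphaStar k * (n : ℝ) ^ k / (k.factorial : ℝ) := by
  obtain ⟨D, hD⟩ := starExtremal_mem k n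
  rw [← hD]
  simpa using starCount_le k hk D

lemma le_starExtremal {V : Type} [Fintype V] (k n : ℕ) (e : Fin n ≃ V) (D : V → V → Prop) :
    starCount k D ≤ starExtremal k n := by
  have h : starCount k (fun a b => D (e a) (e b)) ≤ starExtremal k n :=
    le_csSup (starExtremal_bdd k n) ⟨_, rfl⟩
  refine le_trans ?_ h
  rw [starCount_eq_sum, starCount_eq_sum, ← Equiv.sum_comp (Equiv.finsetCongr e)]
  refine Finset.sum_le_sum fun S _ => ?_
  apply chi_pull e
  · simp
  · intro p hp
    simpa using hp
  · intro v hv _ _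
    refine ⟨e.symm v, ?_, ?_⟩
    · simpa [Finset.mem_map_equiv] using hv
    · intro p _
      exact e.eq_symm_apply.symm

/-- the iterated construction -/
def iterD {m j : ℕ} (D : Fin j → Fin j → Prop) : Fin m ⊕ Fin j → Fin m ⊕ Fin j → Prop
  | Sum.inr a, Sum.inr b => D a b ∧ a ≠ b
  | Sum.inr _, Sum.inl _ => True
  | Sum.inl _, _ => False

lemma starExtremal_rec (k : ℕ) (hk : 3 ≤ k) (m j : ℕ) :
    m.choose (k - 1) * j + starExtremal k j ≤ starExtremal k (m + j) := by
  classical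
  obtain ⟨D, hD⟩ := starExtremal_mem k j
  refine le_trans ?_ (le_starExtremal k (m + j) finSumFinEquiv.symm (iterD (m := m) D))
  rw [← hD]
  let A : Finset (Finset (Fin m ⊕ Fin j)) :=
    ((Finset.univ : Finset (Fin m)).powersetCard (k - 1) ×ˢ (Finset.univ : Finset (Fin j))).image
      fun z => z.1.disjSum {z.2}
  let B : Set (Finset (Fin m ⊕ Fin j)) :=
    (fun S : Finset (Fin j) => (∅ : Finset (Fin m)).disjSum S) '' {S : Finset (Fin j) | S.card = k ∧
      ∃ v ∈ S, ∀ u ∈ S, ∀ w ∈ S, (D u w ↔ (u = v ∧ w ≠ v))}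
  have hinj : ∀ (a a' : Finset (Fin m)) (b b' : Finset (Fin j)),
      a.disjSum b = a'.disjSum b' → a = a' ∧ b = b' := by
    intro a a' b b' h
    constructor
    · ext x
      rw [← Finset.inl_mem_disjSum (t := b), h, Finset.inl_mem_disjSum]
    · ext x
      rw [← Finset.inr_mem_disjSum (s := a), h, Finset.inr_mem_disjSum]
  have hA : A.card = m.choose (k - 1) * j := by
    rw [Finset.card_image_of_injective]
    · rw [Finset.card_product, Finset.card_powersetCard]; simp
    · rintro ⟨a, b⟩ ⟨a', b'⟩ h
      obtain ⟨h1, h2⟩ := hinj _ _ _ _ h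
      simp only [Finset.singleton_inj] at h2
      simp only at h1
      rw [h1, h2]
  have hB : B.ncard = starCount k D := by
    unfold starCount
    apply Set.ncard_image_of_injective
    intro a b h
    exact (hinj _ _ _ _ h).2
  have hdisj : Disjoint (A : Set (Finset (Fin m ⊕ Fin j))) B := by
    rw [Set.disjoint_left]
    rintro S hS ⟨T, _, rfl⟩
    simp only [A, Finset.mem_coe, Finset.mem_image, Finset.mem_product,
      Finset.mem_powersetCard] at hS
    obtain ⟨⟨a, b⟩, ⟨⟨_, hc⟩, _⟩, h⟩ := hS
    have := (hinj _ _ _ _ h).1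
    simp only at this hc
    rw [this] at hc
    simp at hc
    omega
  rw [← hA, ← hB, ← Set.ncard_coe_finset, ← Set.ncard_union_eq hdisj (Set.toFinite _)
    (Set.toFinite _)]
  unfold starCount
  apply Set.ncard_le_ncard _ (Set.toFinite _)
  rintro S (hS | hS)
  · simp only [A, Finset.mem_coe, Finset.mem_image, Finset.mem_product,
      Finset.mem_powersetCard] at hS
    obtain ⟨⟨a, b⟩, ⟨⟨_, hc⟩, _⟩, rfl⟩ := hS
    simp only at hc
    refine ⟨?_, Sum.inr b, by simp, ?_⟩
    · rw [Finset.card_disjSum, hc]; simp; omega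
    · intro p hp q hq
      rcases p with p | p <;> rcases q with q | q
      · simp [iterD]
      · simp [iterD]
      · simp only [Finset.inr_mem_disjSum, Finset.mem_singleton] at hp
        simp [iterD, hp]
      · simp only [Finset.inr_mem_disjSum, Finset.mem_singleton] at hp hq
        subst hp; subst hq
        simp [iterD]
  · obtain ⟨T, ⟨hc, v, hv, h⟩, rfl⟩ := hS
    refine ⟨by simpa using hc, Sum.inr v, by simpa using hv, ?_⟩
    intro p hp q hq
    rcases p with p | p
    · simp at hp
    rcases q with q | q
    · simp at hq
    simp only [Finset.inr_mem_disjSum] at hp hq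
    have := h p hp q hq
    simp only [iterD, Sum.inr.injEq, ne_eq]
    grind

open Filter Topology in
lemma choose_ratio (u : ℕ → ℕ) (y : ℝ) (hy : 0 < y) (i : ℕ)
    (hu : Tendsto (fun n => (u n : ℝ) / n) atTop (𝓝 y)) :
    Tendsto (fun n => ((u n).choose i : ℝ) / (n : ℝ) ^ i) atTop (𝓝 (y ^ i / i.factorial)) := by
  have hinf : Tendsto u atTop atTop := by
    rw [← tendsto_natCast_atTop_iff (R := ℝ)]
    refine (hu.pos_mul_atTop hy tendsto_natCast_atTop_atTop).congr' ?_
    filter_upwards [eventually_gt_atTop 0] with n hn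
    have : (n : ℝ) ≠ 0 := by positivity
    field_simp
  have h0 : ∀ᶠ n : ℕ in atTop, (n : ℝ) ^ i / i.factorial ≠ 0 := by
    filter_upwards [eventually_gt_atTop 0] with n hn
    positivity
  have h1 := (Asymptotics.isEquivalent_iff_tendsto_one h0).1 (isEquivalent_choose i)
  have h2 := (h1.comp hinf).mul ((hu.pow i).div_const (i.factorial : ℝ))
  rw [one_mul] at h2
  refine h2.congr' ?_
  filter_upwards [eventually_gt_atTop 0, hinf.eventually_gt_atTop 0] with n hn hun
  have : (n : ℝ) ≠ 0 := by positivity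
  have : (u n : ℝ) ≠ 0 := by positivity
  simp only [Function.comp, Pi.div_apply]
  rw [div_pow (u n : ℝ)]
  field_simp

open Filter Topology in
lemma liminf_ge (k : ℕ) (hk : 3 ≤ k) (x : ℝ) (hx0 : 0 < x) (hx1 : x < 1) (c : ℝ)
    (hc : c < k * x * (1 - x) ^ (k - 1) / (1 - x ^ k)) :
    ∀ᶠ n : ℕ in atTop, c < (starExtremal k n : ℝ) / (n.choose k : ℝ) := by
  set a : ℕ → ℝ := fun n => (starExtremal k n : ℝ) / (n.choose k : ℝ) with ha
  have hxk : x ^ k ≤ x := pow_le_of_le_one hx0.le hx1.le (by omega)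
  let u : ℕ → ℕ := fun n => ⌊x * n⌋₊
  have hu : Tendsto (fun n => (u n : ℝ) / n) atTop (𝓝 x) :=
    (tendsto_nat_floor_mul_div_atTop hx0.le).comp tendsto_natCast_atTop_atTop
  have hun : ∀ n, u n ≤ n := by
    intro n
    have : x * n ≤ n := by nlinarith [(Nat.cast_nonneg n : (0:ℝ) ≤ n)]
    exact Nat.floor_le_of_le this
  have hm : Tendsto (fun n => ((n - u n : ℕ) : ℝ) / n) atTop (𝓝 (1 - x)) := by
    refine (tendsto_const_nhds.sub hu).congr' ?_
    filter_upwards [eventually_gt_atTop 0] with n hn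
    have : (n : ℝ) ≠ 0 := by positivity
    rw [Nat.cast_sub (hun n)]
    field_simp
  have hinf : Tendsto u atTop atTop :=
    tendsto_nat_floor_atTop.comp (tendsto_natCast_atTop_atTop.const_mul_atTop hx0)
  have hn1 : Tendsto (fun n : ℕ => (n : ℝ) / n) atTop (𝓝 1) := by
    refine tendsto_const_nhds.congr' ?_
    filter_upwards [eventually_gt_atTop 0] with n hn
    have : (n : ℝ) ≠ 0 := by positivity
    field_simp
  have hC := choose_ratio (fun n => n) 1 one_pos k hn1
  have hCm := choose_ratio _ _ (by linarith : 0 < 1 - x) (k - 1) hm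
  have hCu := choose_ratio _ _ hx0 k hu
  have hkf : (k.factorial : ℝ) = k * (k - 1).factorial := by
    obtain ⟨m, rfl⟩ : ∃ m, k = m + 1 := ⟨k - 1, by omega⟩
    rw [Nat.factorial_succ]; push_cast; simp
  have hf : (0 : ℝ) < (k - 1).factorial := by exact_mod_cast Nat.factorial_pos _
  have hk0 : (0 : ℝ) < k := by exact_mod_cast (by omega : 0 < k)
  have hfk : (0 : ℝ) < k.factorial := by exact_mod_cast Nat.factorial_pos _
  have hne : (1 : ℝ) ^ k / k.factorial ≠ 0 := by positivity
  -- limits of the two coefficients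
  let g : ℕ → ℝ := fun n => ((n - u n).choose (k - 1) : ℝ) * u n / (n.choose k : ℝ)
  let h : ℕ → ℝ := fun n => ((u n).choose k : ℝ) / (n.choose k : ℝ)
  have hg : Tendsto g atTop (𝓝 (k * x * (1 - x) ^ (k - 1))) := by
    have h1 := (hCm.mul hu).div hC hne
    have e : (1 - x) ^ (k - 1) / ((k - 1).factorial : ℝ) * x / (1 ^ k / (k.factorial : ℝ)) =
        k * x * (1 - x) ^ (k - 1) := by
      rw [hkf]; field_simp; simp
    rw [e] at h1
    refine h1.congr' ?_
    filter_upwards [eventually_gt_atTop 0] with n hn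
    have hn0 : (n : ℝ) ≠ 0 := by positivity
    have e2 : (n : ℝ) ^ k = n ^ (k - 1) * n := by
      rw [← pow_succ]; congr 1; omega
    simp only [g, Pi.div_apply]
    rw [e2]
    field_simp
  have hh : Tendsto h atTop (𝓝 (x ^ k)) := by
    have h1 := hCu.div hC hne
    have e : x ^ k / (k.factorial : ℝ) / (1 ^ k / (k.factorial : ℝ)) = x ^ k := by
      field_simp; simp
    rw [e] at h1
    refine h1.congr' ?_
    filter_upwards [eventually_gt_atTop 0] with n hn
    have hn0 : (n : ℝ) ≠ 0 := by positivity
    simp only [h, Pi.div_apply]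
    field_simp
  have hrec : ∀ᶠ n in atTop, g n + h n * a (u n) ≤ a n := by
    filter_upwards [eventually_ge_atTop k, hinf.eventually_ge_atTop k] with n hn hun'
    have h1 := starExtremal_rec k hk (n - u n) (u n)
    rw [Nat.sub_add_cancel (hun n)] at h1
    have h1' : (((n - u n).choose (k - 1) : ℝ) * u n + starExtremal k (u n)) ≤
      starExtremal k n := by exact_mod_cast h1
    have hp1 : (0 : ℝ) < n.choose k := by exact_mod_cast Nat.choose_pos hn
    have hp2 : (0 : ℝ) < (u n).choose k := by exact_mod_cast Nat.choose_pos hun'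
    have e : g n + h n * a (u n) =
        (((n - u n).choose (k - 1) : ℝ) * u n + starExtremal k (u n)) / n.choose k := by
      simp only [g, h, ha]
      field_simp
    rw [e]
    exact div_le_div_of_nonneg_right h1' hp1.le
  -- boundedness
  have hub : ∃ M, ∀ᶠ n in atTop, a n ≤ M := by
    have h1 := (tendsto_const_nhds (x := alphaStar k / k.factorial)).div hC hne
    refine ⟨alphaStar k / k.factorial / (1 ^ k / k.factorial) + 1, (h1.eventually_le_const (lt_add_one _)).mono
       fun n hn => ?_⟩
    refine le_trans ?_ hn
    simp only [ha, Pi.div_apply]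
    have := starExtremal_le k hk n
    refine (div_le_div_of_nonneg_right this (Nat.cast_nonneg _)).trans (le_of_eq ?_)
    rw [div_div_eq_mul_div]
    ring
  obtain ⟨M, hM⟩ := hub
  -- the set of eventual lower bounds
  let E : Set ℝ := {b | ∀ᶠ n in atTop, b ≤ a n}
  have hE0 : (0 : ℝ) ∈ E := Eventually.of_forall fun n => by simp only [ha]; positivity
  have hEb : BddAbove E := ⟨M, fun b hb => by
    obtain ⟨n, h1, h2⟩ := (hb.and hM).exists
    exact h1.trans h2⟩
  set L := sSup E with hL
  have hstep : ∀ b ∈ E, k * x * (1 - x) ^ (k - 1) + x ^ k * b ≤ L := by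
    intro b hb
    apply le_of_forall_lt
    intro d hd
    obtain ⟨d', hd1, hd2⟩ := exists_between hd
    refine lt_of_lt_of_le hd1 (le_csSup hEb ?_)
    have hlim := hg.add (hh.mul_const b)
    filter_upwards [hrec, hlim.eventually_const_lt hd2, hinf.eventually hb] with n h1 h2 h3
    have : h n * b ≤ h n * a (u n) := mul_le_mul_of_nonneg_left h3 (by simp only [h]; positivity)
    linarith
  have hfin : k * x * (1 - x) ^ (k - 1) / (1 - x ^ k) ≤ L := by
    rw [div_le_iff₀ (by linarith)]
    have hxp : 0 < x ^ k := by positivity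
    have : L ≤ (L - k * x * (1 - x) ^ (k - 1)) / x ^ k := by
      apply csSup_le ⟨0, hE0⟩
      intro b hb
      rw [le_div_iff₀ hxp]
      linarith [hstep b hb]
    rw [le_div_iff₀ hxp] at this
    linarith
  obtain ⟨b, hb, hcb⟩ := exists_lt_of_lt_csSup ⟨0, hE0⟩ (lt_of_lt_of_le hc hfin)
  exact Eventually.mono hb fun n hn => lt_of_lt_of_le hcb hn

theorem star_inducibility_limit (k : ℕ) (hk : 3 ≤ k) :
    Filter.Tendsto (fun n : ℕ => (starExtremal k n : ℝ) / (n.choose k : ℝ))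
      Filter.atTop (nhds (alphaStar k)) := by
  rw [tendsto_order]
  constructor
  · intro c hc
    rcases lt_or_ge c 0 with h0 | h0
    · exact Filter.Eventually.of_forall fun n => lt_of_lt_of_le h0 (by positivity)
    obtain ⟨_, ⟨x, ⟨hx0, hx1⟩, rfl⟩, hcx⟩ := exists_lt_of_lt_csSup
      (Set.Nonempty.image _ ⟨0, by simp⟩) hc
    rcases hx0.eq_or_lt with rfl | hx0
    · simp at hcx
      linarith
    · exact liminf_ge k hk x hx0 hx1 c hcx
  · intro c hc
    have hn1 : Filter.Tendsto (fun n : ℕ => (n : ℝ) / n) Filter.atTop (nhds 1) := by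
      refine tendsto_const_nhds.congr' ?_
      filter_upwards [Filter.eventually_gt_atTop 0] with n hn
      have : (n : ℝ) ≠ 0 := by positivity
      field_simp
    have hC := choose_ratio (fun n => n) 1 one_pos k hn1
    have hfk : (0 : ℝ) < k.factorial := by exact_mod_cast Nat.factorial_pos _
    have hne : (1 : ℝ) ^ k / k.factorial ≠ 0 := by positivity
    have h1 := (tendsto_const_nhds (x := alphaStar k / k.factorial)).div hC hne
    have e : alphaStar k / (k.factorial : ℝ) / (1 ^ k / (k.factorial : ℝ)) = alphaStar k := by
      field_simp; simp
    rw [e] at h1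
    filter_upwards [h1.eventually_lt_const hc] with n hn
    refine lt_of_le_of_lt ?_ hn
    simp only [Pi.div_apply]
    have := starExtremal_le k hk n
    refine (div_le_div_of_nonneg_right this (Nat.cast_nonneg _)).trans (le_of_eq ?_)
    rw [div_div_eq_mul_div]
    ring
end

section
/- For all integers 2 ≤ s ≤ t, the sequence n ↦ b_{s,t}(n)/C(n,s+t), where b_{s,t}(n) is the supremum over all digraphs D on n vertices of the number of (s+t)-element vertex subsets of D inducing a copy of K⃗_{s,t}, converges as n → ∞ to C(s+t,s)·(s/(s+t))^s·(t/(s+t))^t. -/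
/-- The number of `(s+t)`-element vertex subsets of the digraph `D` inducing a
copy of the complete bipartite digraph `K⃗_{s,t}`. -/
noncomputable def kstCount (s t : ℕ) {V : Type} [Fintype V] (D : V → V → Prop) : ℕ :=
  {S : Finset V | S.card = s + t ∧
    ∃ A ⊆ S, A.card = s ∧ ∀ u ∈ S, ∀ w ∈ S, (D u w ↔ (u ∈ A ∧ w ∉ A))}.ncard

/-- `b_{s,t}(n)`: the supremum over digraphs on `n` vertices of the number of
`(s+t)`-subsets inducing a copy of `K⃗_{s,t}`. -/
noncomputable def kstExtremal (s t n : ℕ) : ℕ :=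
  sSup {m : ℕ | ∃ D : Fin n → Fin n → Prop, kstCount s t D = m}


/-- The larger of the two monomials attached to a pair of parts. -/
noncomputable def pairG (s t : ℕ) (a b : ℝ) : ℝ := max (a ^ s * b ^ t) (b ^ s * a ^ t)

lemma pairG_comm (s t : ℕ) (a b : ℝ) : pairG s t a b = pairG s t b a := max_comm _ _

lemma pairG_of_le {s t : ℕ} (hst : s ≤ t) {a b : ℝ} (ha : 0 ≤ a) (hab : a ≤ b) :
    pairG s t a b = a ^ s * b ^ t := by
  unfold pairG
  apply max_eq_left
  obtain ⟨d, rfl⟩ := Nat.exists_eq_add_of_le hst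
  have hb := ha.trans hab
  have h : a ^ d ≤ b ^ d := pow_le_pow_left₀ ha hab d
  have := mul_le_mul_of_nonneg_left h (show 0 ≤ a ^ s * b ^ s by positivity)
  rw [pow_add, pow_add]
  nlinarith

lemma amgm_pow (s t : ℕ) (hs : 1 ≤ s) (ht : 1 ≤ t) {x y : ℝ} (hx : 0 ≤ x) (hy : 0 ≤ y) :
    x ^ s * y ^ t ≤ ((s : ℝ) / (s + t)) ^ s * ((t : ℝ) / (s + t)) ^ t * (x + y) ^ (s + t) := by
  have hs' : (0 : ℝ) < s := by exact_mod_cast hs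
  have ht' : (0 : ℝ) < t := by exact_mod_cast ht
  have h := Real.geom_mean_le_arith_mean2_weighted (w₁ := s / (s + t)) (w₂ := t / (s + t))
    (p₁ := x / s) (p₂ := y / t) (by positivity) (by positivity) (by positivity) (by positivity)
    (by field_simp)
  have h2 := pow_le_pow_left₀ (by positivity) h (s + t)
  have e1 : ((x / s) ^ ((s : ℝ) / (s + t)) * (y / t) ^ ((t : ℝ) / (s + t))) ^ (s + t)
      = (x / s) ^ s * (y / t) ^ t := by
    rw [mul_pow, ← Real.rpow_natCast, ← Real.rpow_natCast, ← Real.rpow_mul (by positivity),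
      ← Real.rpow_mul (by positivity)]
    rw [← Real.rpow_natCast (x / s) s, ← Real.rpow_natCast (y / t) t]
    push_cast
    congr 2 <;> field_simp
  have e2 : (s : ℝ) / (s + t) * (x / s) + t / (s + t) * (y / t) = (x + y) / (s + t) := by
    field_simp
  rw [e1, e2] at h2
  have h3 := mul_le_mul_of_nonneg_left h2 (show (0:ℝ) ≤ (s:ℝ) ^ s * (t:ℝ) ^ t by positivity)
  calc x ^ s * y ^ t = (s:ℝ) ^ s * (t:ℝ) ^ t * ((x / s) ^ s * (y / t) ^ t) := by
        rw [div_pow, div_pow]; field_simp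
    _ ≤ _ := h3
    _ = _ := by rw [div_pow, div_pow, div_pow, pow_add (s + t : ℝ)]; field_simp

lemma super_pow (s : ℕ) (hs : 1 ≤ s) {a b : ℝ} (ha : 0 ≤ a) (hb : 0 ≤ b) :
    a ^ s + b ^ s ≤ (a + b) ^ s := by
  induction s, hs using Nat.le_induction with
  | base => simp
  | succ n hn ih =>
    have h1 : (0:ℝ) ≤ a ^ n := by positivity
    have h2 : (0:ℝ) ≤ b ^ n := by positivity
    calc a ^ (n+1) + b ^ (n+1) ≤ (a ^ n + b ^ n) * (a + b) := by
          rw [pow_succ, pow_succ]; nlinarith [mul_nonneg h1 hb, mul_nonneg h2 ha]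
      _ ≤ (a+b)^n * (a+b) := by gcongr
      _ = _ := by ring

/-- superadditivity with slack -/
lemma super_pow2 (s : ℕ) (hs : 2 ≤ s) {a b : ℝ} (hb : 0 ≤ b) (hab : b ≤ a) :
    a ^ s + b ^ s + b ^ s ≤ (a + b) ^ s := by
  have ha := hb.trans hab
  induction s, hs using Nat.le_induction with
  | base => nlinarith
  | succ n hn ih =>
    have h1 : (0:ℝ) ≤ a ^ n := by positivity
    have h2 : (0:ℝ) ≤ b ^ n := by positivity
    calc a ^ (n+1) + b ^ (n+1) + b ^ (n+1) ≤ (a ^ n + b ^ n + b ^ n) * (a + b) := by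
          rw [pow_succ, pow_succ]; nlinarith [mul_nonneg h1 hb, mul_nonneg h2 ha]
      _ ≤ (a+b)^n * (a+b) := by gcongr
      _ = _ := by ring

/-- Sum over ordered pairs of distinct elements. -/
noncomputable def pairSum {ι : Type*} [DecidableEq ι] (s t : ℕ) (I : Finset ι) (x : ι → ℝ) : ℝ :=
  ∑ i ∈ I, ∑ j ∈ I, if i = j then 0 else pairG s t (x i) (x j)

lemma pairSum_insert {ι : Type*} [DecidableEq ι] (s t : ℕ) (I : Finset ι) (x : ι → ℝ) (a : ι)
    (ha : a ∉ I) :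
    pairSum s t (insert a I) x = pairSum s t I x + 2 * ∑ j ∈ I, pairG s t (x a) (x j) := by
  unfold pairSum
  rw [Finset.sum_insert ha, Finset.sum_insert ha]
  simp only [if_true, zero_add]
  have h1 : ∀ i ∈ I, (∑ j ∈ insert a I, if i = j then 0 else pairG s t (x i) (x j))
      = pairG s t (x a) (x i) + ∑ j ∈ I, if i = j then 0 else pairG s t (x i) (x j) := by
    intro i hi
    rw [Finset.sum_insert ha, if_neg (by rintro rfl; exact ha hi), pairG_comm]
  rw [Finset.sum_congr rfl h1, Finset.sum_add_distrib]
  have h2 : ∑ j ∈ I, (if a = j then 0 else pairG s t (x a) (x j))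
      = ∑ j ∈ I, pairG s t (x a) (x j) := by
    apply Finset.sum_congr rfl
    intro j hj
    rw [if_neg (by rintro rfl; exact ha hj)]
  rw [h2]; ring

lemma pairSum_le {ι : Type*} [DecidableEq ι] (s t : ℕ) (hs : 2 ≤ s) (hst : s ≤ t) (k : ℕ) :
    ∀ (I : Finset ι) (x : ι → ℝ), I.card = k → (∀ i ∈ I, 0 ≤ x i) →
    pairSum s t I x ≤
      2 * (((s : ℝ) / (s + t)) ^ s * ((t : ℝ) / (s + t)) ^ t * (∑ i ∈ I, x i) ^ (s + t)) := by
  induction k with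
  | zero =>
    intro I x hI hx
    rw [Finset.card_eq_zero] at hI
    subst hI
    simp only [pairSum, Finset.sum_empty]
    positivity
  | succ k ih =>
    intro I x hI hx
    obtain ⟨b, hbI, hbmin⟩ := Finset.exists_min_image I x (Finset.card_pos.mp (by omega))
    obtain ⟨K, hbK, rfl⟩ : ∃ K, b ∉ K ∧ I = insert b K :=
      ⟨I.erase b, by simp, (Finset.insert_erase hbI).symm⟩
    rw [Finset.card_insert_of_notMem hbK] at hI
    have hb0 : 0 ≤ x b := hx b (by simp)
    rcases K.eq_empty_or_nonempty with rfl | hK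
    · simp [pairSum]
      positivity
    obtain ⟨a, haK, hamin⟩ := Finset.exists_min_image K x hK
    obtain ⟨J, haJ, rfl⟩ : ∃ J, a ∉ J ∧ K = insert a J :=
      ⟨K.erase a, by simp, (Finset.insert_erase haK).symm⟩
    have ha0 : 0 ≤ x a := hx a (by simp)
    have hba : x b ≤ x a := hbmin a (by simp)
    rcases J.eq_empty_or_nonempty with rfl | ⟨m, hm⟩
    · rw [pairSum_insert _ _ _ _ _ hbK, pairSum_insert _ _ _ _ _ haJ]
      rw [Finset.sum_insert hbK]
      simp only [pairSum, insert_empty_eq, Finset.sum_singleton, Finset.sum_empty]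
      rw [pairG_of_le hst hb0 hba]
      have := amgm_pow s t (by omega) (by omega) hb0 ha0
      linarith
    · have hbJ : b ∉ J := fun h => hbK (by simp [h])
      set x' : ι → ℝ := Function.update x a (x a + x b) with hx'
      have hx'a : x' a = x a + x b := by simp [hx']
      have hx'J : ∀ i ∈ J, x' i = x i := by
        intro i hi
        rw [hx', Function.update_of_ne]
        rintro rfl; exact haJ hi
      have IH := ih (insert a J) x' (by omega) (by
        intro i hi
        rcases Finset.mem_insert.mp hi with rfl | hi
        · rw [hx'a]; positivity
        · rw [hx'J i hi]; exact hx i (by simp [hi]))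
      have hsum : ∑ i ∈ insert a J, x' i = ∑ i ∈ insert b (insert a J), x i := by
        rw [Finset.sum_insert haJ, Finset.sum_insert hbK, Finset.sum_insert haJ, hx'a,
          Finset.sum_congr rfl hx'J]
        ring
      rw [hsum] at IH
      refine le_trans ?_ IH
      rw [pairSum_insert _ _ _ _ _ hbK, pairSum_insert _ _ _ _ _ haJ,
        pairSum_insert _ _ _ _ _ haJ, Finset.sum_insert haJ]
      have e1 : pairSum s t J x' = pairSum s t J x := by
        unfold pairSum
        refine Finset.sum_congr rfl fun i hi => Finset.sum_congr rfl fun j hj => ?_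
        rw [hx'J i hi, hx'J j hj]
      have e2 : ∑ j ∈ J, pairG s t (x' a) (x' j) = ∑ j ∈ J, pairG s t (x a + x b) (x j) := by
        refine Finset.sum_congr rfl fun j hj => ?_
        rw [hx'J j hj, hx'a]
      rw [e1, e2]
      have hstep : ∀ j ∈ J, pairG s t (x a) (x j) + pairG s t (x b) (x j)
          ≤ pairG s t (x a + x b) (x j) := by
        intro j hj
        have haj : x a ≤ x j := hamin j (by simp [hj])
        have hj0 := ha0.trans haj
        rw [pairG_of_le hst ha0 haj, pairG_of_le hst hb0 (hba.trans haj)]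
        refine le_trans ?_ (le_max_left _ _)
        rw [← add_mul]
        exact mul_le_mul_of_nonneg_right (super_pow s (by omega) ha0 hb0) (by positivity)
      have hstepm : pairG s t (x a) (x m) + pairG s t (x b) (x m) + pairG s t (x b) (x a)
          ≤ pairG s t (x a + x b) (x m) := by
        have haj : x a ≤ x m := hamin m (by simp [hm])
        have hj0 := ha0.trans haj
        rw [pairG_of_le hst ha0 haj, pairG_of_le hst hb0 (hba.trans haj),
          pairG_of_le hst hb0 hba]
        refine le_trans ?_ (le_max_left _ _)
        have h1 : x b ^ s * x a ^ t ≤ x b ^ s * x m ^ t := by gcongr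
        have h2 := mul_le_mul_of_nonneg_right (super_pow2 s hs hb0 hba)
          (show 0 ≤ x m ^ t by positivity)
        nlinarith
      have hJ : ∑ j ∈ J, pairG s t (x a) (x j) + ∑ j ∈ J, pairG s t (x b) (x j)
          + pairG s t (x b) (x a) ≤ ∑ j ∈ J, pairG s t (x a + x b) (x j) := by
        rw [← Finset.sum_add_distrib, ← Finset.add_sum_erase _ _ hm,
          ← Finset.add_sum_erase J (fun j => pairG s t (x a + x b) (x j)) hm]
        have := Finset.sum_le_sum (s := J.erase m) fun j hj => hstep j (Finset.mem_of_mem_erase hj)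
        linarith
      linarith

lemma orientedSum_le {ι : Type*} [DecidableEq ι] (s t : ℕ) (hs : 2 ≤ s) (hst : s ≤ t)
    (I : Finset ι) (x : ι → ℝ) (hx : ∀ i, 0 ≤ x i) (R : ι → ι → Prop) [DecidableRel R]
    (hR : ∀ i j, R i j → ¬ R j i) :
    (∑ i ∈ I, ∑ j ∈ I, if R i j then x i ^ s * x j ^ t else 0) ≤
      ((s : ℝ) / (s + t)) ^ s * ((t : ℝ) / (s + t)) ^ t * (∑ i ∈ I, x i) ^ (s + t) := by
  have h1 := pairSum_le s t hs hst _ I x rfl (fun i _ => hx i)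
  have h2 : (∑ i ∈ I, ∑ j ∈ I, if R i j then x i ^ s * x j ^ t else 0) +
      (∑ i ∈ I, ∑ j ∈ I, if R i j then x i ^ s * x j ^ t else 0) ≤ pairSum s t I x := by
    nth_rw 2 [Finset.sum_comm]
    rw [← Finset.sum_add_distrib]
    refine Finset.sum_le_sum fun i _ => ?_
    rw [← Finset.sum_add_distrib]
    refine Finset.sum_le_sum fun j _ => ?_
    have hi := hx i
    have hj := hx j
    by_cases hij : i = j
    · subst hij
      have : ¬ R i i := fun h => hR i i h h
      simp [this]
    · rw [if_neg hij]
      by_cases h : R i j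
      · rw [if_pos h, if_neg (hR _ _ h), add_zero]
        exact le_max_left _ _
      · rw [if_neg h, zero_add]
        split_ifs
        · exact le_max_right _ _
        · exact le_max_of_le_left (by positivity)
  linarith

/-- `S` induces a copy of `K⃗_{s,t}` in `D`. -/
def IsCopy (s t : ℕ) {V : Type} (D : V → V → Prop) (S : Finset V) : Prop :=
  S.card = s + t ∧
    ∃ A ⊆ S, A.card = s ∧ ∀ u ∈ S, ∀ w ∈ S, (D u w ↔ (u ∈ A ∧ w ∉ A))

open Classical in
/-- The finset of copies. -/
noncomputable def copies (s t : ℕ) {V : Type} [Fintype V] (D : V → V → Prop) :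
    Finset (Finset V) := Finset.univ.filter (IsCopy s t D)

lemma kstCount_eq (s t : ℕ) {V : Type} [Fintype V] (D : V → V → Prop) :
    kstCount s t D = (copies s t D).card := by
  classical
  unfold kstCount
  rw [← Set.ncard_coe_finset]
  congr 1
  ext S
  simp [copies, IsCopy]

lemma IsCopy.map {s t : ℕ} {V : Type} {D D' : V → V → Prop} {S : Finset V} (e : V ≃ V)
    (h : IsCopy s t D S) (he : ∀ x ∈ S, ∀ y ∈ S, (D' (e x) (e y) ↔ D x y)) :
    IsCopy s t D' (S.map e.toEmbedding) := by
  obtain ⟨h1, A, hA, h2, h3⟩ := h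
  refine ⟨by simpa using h1, A.map e.toEmbedding, Finset.map_subset_map.mpr hA,
    by simpa using h2, ?_⟩
  intro u hu w hw
  obtain ⟨x, hx, rfl⟩ := Finset.mem_map.mp hu
  obtain ⟨y, hy, rfl⟩ := Finset.mem_map.mp hw
  have := h3 x hx y hy
  simp only [Equiv.coe_toEmbedding, Finset.mem_map_equiv, Equiv.symm_apply_apply]
  rw [he x hx y hy, this]

lemma IsCopy.congr {s t : ℕ} {V : Type} {D D' : V → V → Prop} {S : Finset V}
    (h : IsCopy s t D S) (he : ∀ x ∈ S, ∀ y ∈ S, (D' x y ↔ D x y)) : IsCopy s t D' S := by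
  have := h.map (D' := D') (Equiv.refl V) he
  simpa using this

/-- The retraction sending `u` to `v`. -/
def sigmaMap {V : Type} [DecidableEq V] (u v : V) (x : V) : V := if x = u then v else x

/-- `u` becomes a clone of `v`. -/
def cloneD {V : Type} [DecidableEq V] (D : V → V → Prop) (u v : V) : V → V → Prop :=
  fun x y => D (sigmaMap u v x) (sigmaMap u v y)

lemma clone_of_ne {V : Type} [DecidableEq V] (D : V → V → Prop) (u v x y : V) (hx : x ≠ u)
    (hy : y ≠ u) : cloneD D u v x y ↔ D x y := by
  simp [cloneD, sigmaMap, hx, hy]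

lemma IsCopy.clone_both {s t : ℕ} {V : Type} [DecidableEq V] {D : V → V → Prop} {S : Finset V}
    {u v : V} (h : IsCopy s t D S) (hu : u ∈ S) (hv : v ∈ S)
    (h1 : ¬ D u v) (h2 : ¬ D v u) : IsCopy s t (cloneD D u v) S := by
  refine h.congr ?_
  obtain ⟨-, A, hA, -, h3⟩ := h
  have key : u ∈ A ↔ v ∈ A := by
    have a1 := h3 u hu v hv
    have a2 := h3 v hv u hu
    tauto
  intro x hx y hy
  unfold cloneD
  have hσ : ∀ z ∈ S, sigmaMap u v z ∈ S := by
    intro z hz; unfold sigmaMap; split_ifs <;> assumption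
  have hσA : ∀ z, sigmaMap u v z ∈ A ↔ z ∈ A := by
    intro z; unfold sigmaMap
    split_ifs with hz
    · rw [hz, key]
    · rfl
  rw [h3 _ (hσ x hx) _ (hσ y hy), h3 x hx y hy, hσA, hσA]

/-- copies containing `u` and not `v` -/
noncomputable def exclCopies (s t : ℕ) {V : Type} [Fintype V] [DecidableEq V]
    (D : V → V → Prop) (u v : V) : Finset (Finset V) :=
  (copies s t D).filter (fun S => u ∈ S ∧ v ∉ S)

lemma mem_copies {s t : ℕ} {V : Type} [Fintype V] {D : V → V → Prop} {S : Finset V} :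
    S ∈ copies s t D ↔ IsCopy s t D S := by simp [copies]

lemma clone_count (s t : ℕ) {V : Type} [Fintype V] [DecidableEq V] (D : V → V → Prop) (u v : V)
    (h1 : ¬ D u v) (h2 : ¬ D v u) :
    (copies s t D).card + (exclCopies s t D v u).card ≤
      (copies s t (cloneD D u v)).card + (exclCopies s t D u v).card := by
  classical
  have hsub : (copies s t D \ exclCopies s t D u v) ∪
      (exclCopies s t D v u).map (Equiv.finsetCongr (Equiv.swap u v)).toEmbedding
      ⊆ copies s t (cloneD D u v) := by
    intro S hS
    rw [mem_copies]
    rcases Finset.mem_union.mp hS with hS | hS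
    · simp only [exclCopies, Finset.mem_sdiff, Finset.mem_filter, mem_copies, not_and,
        not_not] at hS
      obtain ⟨hc, hS⟩ := hS
      by_cases hu : u ∈ S
      · exact hc.clone_both hu (hS hc hu) h1 h2
      · refine hc.congr fun x hx y hy => clone_of_ne D u v x y ?_ ?_
        · rintro rfl; exact hu hx
        · rintro rfl; exact hu hy
    · obtain ⟨S, hS0, rfl⟩ := Finset.mem_map.mp hS
      obtain ⟨hc, hv, hu⟩ := Finset.mem_filter.mp hS0
      rw [mem_copies] at hc
      refine hc.map (Equiv.swap u v) fun x hx y hy => ?_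
      have hσ : ∀ z ∈ S, sigmaMap u v (Equiv.swap u v z) = z := by
        intro z hz
        have hzu : z ≠ u := by rintro rfl; exact hu hz
        by_cases hzv : z = v
        · subst hzv; simp [sigmaMap]
        · rw [Equiv.swap_apply_of_ne_of_ne hzu hzv]; simp [sigmaMap, hzu]
      unfold cloneD
      rw [hσ x hx, hσ y hy]
  have hdisj : Disjoint (copies s t D \ exclCopies s t D u v)
      ((exclCopies s t D v u).map (Equiv.finsetCongr (Equiv.swap u v)).toEmbedding) := by
    rw [Finset.disjoint_left]
    intro S hS hS'
    obtain ⟨S, hS0, rfl⟩ := Finset.mem_map.mp hS'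
    obtain ⟨-, hv, hu⟩ := Finset.mem_filter.mp hS0
    obtain ⟨hc, hn⟩ := Finset.mem_sdiff.mp hS
    apply hn
    refine Finset.mem_filter.mpr ⟨hc, ?_, ?_⟩
    · simpa [Finset.mem_map_equiv] using hv
    · simpa [Finset.mem_map_equiv] using hu
  have h3 := Finset.card_le_card hsub
  have h5 : exclCopies s t D u v ⊆ copies s t D := Finset.filter_subset _ _
  rw [Finset.card_union_of_disjoint hdisj, Finset.card_map,
    Finset.card_sdiff_of_subset h5] at h3
  have h4 : (exclCopies s t D u v).card ≤ (copies s t D).card :=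
    Finset.card_le_card (Finset.filter_subset _ _)
  omega

/-- twin vertices -/
def Twin {V : Type} (D : V → V → Prop) (x y : V) : Prop :=
  ∀ z, (D x z ↔ D y z) ∧ (D z x ↔ D z y)

lemma Twin.symm {V : Type} {D : V → V → Prop} {x y : V} (h : Twin D x y) : Twin D y x :=
  fun z => ⟨(h z).1.symm, (h z).2.symm⟩

lemma Twin.trans {V : Type} {D : V → V → Prop} {x y w : V} (h : Twin D x y) (h' : Twin D y w) :
    Twin D x w :=
  fun z => ⟨(h z).1.trans (h' z).1, (h z).2.trans (h' z).2⟩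

lemma Twin.refl {V : Type} (D : V → V → Prop) (x : V) : Twin D x x := fun _ => ⟨Iff.rfl, Iff.rfl⟩

lemma Twin.clone {V : Type} [DecidableEq V] {D : V → V → Prop} {u v x y : V}
    (h : Twin D (sigmaMap u v x) (sigmaMap u v y)) : Twin (cloneD D u v) x y :=
  fun z => ⟨(h (sigmaMap u v z)).1, (h (sigmaMap u v z)).2⟩

open Classical in
/-- twin class -/
noncomputable def twinClass {V : Type} [Fintype V] (D : V → V → Prop) (x : V) : Finset V :=
  Finset.univ.filter (Twin D x)

lemma mem_twinClass {V : Type} [Fintype V] {D : V → V → Prop} {x y : V} :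
    y ∈ twinClass D x ↔ Twin D x y := by simp [twinClass]

/-- number of ordered twin pairs -/
noncomputable def twinPairs {V : Type} [Fintype V] (D : V → V → Prop) : ℕ :=
  ∑ x, (twinClass D x).card

lemma twinPairs_clone {V : Type} [Fintype V] [DecidableEq V] (D : V → V → Prop) (u v : V)
    (huv : ¬ Twin D u v) (hT : (twinClass D u).card ≤ (twinClass D v).card) :
    twinPairs D < twinPairs (cloneD D u v) := by
  classical
  have hne : u ≠ v := by rintro rfl; exact huv (Twin.refl D u)
  have hu : (twinClass D v).card + 1 ≤ (twinClass (cloneD D u v) u).card := by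
    rw [← Finset.card_insert_of_notMem (a := u) (s := twinClass D v)
      (fun h => huv (mem_twinClass.mp h).symm)]
    apply Finset.card_le_card
    intro y hy
    rw [mem_twinClass]
    apply Twin.clone
    by_cases hyu : y = u
    · subst hyu; exact Twin.refl _ _
    · have := (Finset.mem_insert.mp hy).resolve_left hyu
      simpa [sigmaMap, hyu, mem_twinClass] using this
  have hx : ∀ x, x ≠ u → (twinClass D x).card + (if x ∈ twinClass D v then 1 else 0) ≤
      (twinClass (cloneD D u v) x).card + (if x ∈ twinClass D u then 1 else 0) := by
    intro x hxu
    have hsub : (twinClass D x).erase u ⊆ twinClass (cloneD D u v) x := by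
      intro y hy
      rw [Finset.mem_erase, mem_twinClass] at hy
      rw [mem_twinClass]
      apply Twin.clone
      simpa [sigmaMap, hxu, hy.1] using hy.2
    by_cases hxv : x ∈ twinClass D v
    · have hxv' := mem_twinClass.mp hxv
      have hxu' : x ∉ twinClass D u := fun h => huv ((mem_twinClass.mp h).trans hxv'.symm)
      have hux : u ∉ twinClass D x := fun h => hxu' (mem_twinClass.mpr (mem_twinClass.mp h).symm)
      rw [if_pos hxv, if_neg hxu', add_zero, ← Finset.card_insert_of_notMem hux]
      apply Finset.card_le_card
      intro y hy
      by_cases hyu : y = u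
      · subst hyu
        rw [mem_twinClass]
        apply Twin.clone
        simpa [sigmaMap, hxu] using hxv'.symm
      · exact hsub (Finset.mem_erase.mpr ⟨hyu, (Finset.mem_insert.mp hy).resolve_left hyu⟩)
    · rw [if_neg hxv, add_zero]
      have h5 := Finset.card_le_card hsub
      by_cases hxu' : x ∈ twinClass D u
      · rw [if_pos hxu']
        have := Finset.pred_card_le_card_erase (s := twinClass D x) (a := u)
        omega
      · have hux : u ∉ twinClass D x :=
          fun h => hxu' (mem_twinClass.mpr (mem_twinClass.mp h).symm)
        rw [Finset.erase_eq_of_notMem hux] at h5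
        rw [if_neg hxu']; exact h5
  have hsum := Finset.sum_le_sum (s := Finset.univ.erase u)
    (fun x hx' => hx x (Finset.ne_of_mem_erase hx'))
  rw [Finset.sum_add_distrib, Finset.sum_add_distrib] at hsum
  have e1 := Finset.add_sum_erase Finset.univ (fun x => (twinClass D x).card) (Finset.mem_univ u)
  have e2 := Finset.add_sum_erase Finset.univ (fun x => (twinClass (cloneD D u v) x).card)
    (Finset.mem_univ u)
  have e3 := Finset.add_sum_erase Finset.univ (fun x => if x ∈ twinClass D v then 1 else 0)
    (Finset.mem_univ u)
  have e4 := Finset.add_sum_erase Finset.univ (fun x => if x ∈ twinClass D u then 1 else 0)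
    (Finset.mem_univ u)
  have hz : u ∉ twinClass D v := fun h => huv (mem_twinClass.mp h).symm
  have hz' : u ∈ twinClass D u := mem_twinClass.mpr (Twin.refl _ _)
  simp only [if_pos hz', if_neg hz, Finset.sum_ite_mem, Finset.univ_inter, Finset.sum_const,
    smul_eq_mul, mul_one] at e1 e2 e3 e4 hsum
  unfold twinPairs
  omega

lemma exists_good (s t : ℕ) {V : Type} [Fintype V] [DecidableEq V] (D₀ : V → V → Prop) :
    ∃ D : V → V → Prop, (copies s t D₀).card ≤ (copies s t D).card ∧ (∀ x, ¬ D x x) ∧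
      ∀ u v, ¬ D u v → ¬ D v u → Twin D u v := by
  classical
  let X : Set (V → V → Prop) := {D | ∀ x, ¬ D x x}
  have hX : X.Finite := Set.toFinite _
  obtain ⟨D, hD, hmax⟩ := Set.exists_max_image X
    (fun D => (toLex ((copies s t D).card, twinPairs D) : ℕ ×ₗ ℕ)) hX ⟨fun _ _ => False, by simp [X]⟩
  have hmax' : ∀ D' ∈ X, (copies s t D').card < (copies s t D).card ∨
      ((copies s t D').card = (copies s t D).card ∧ twinPairs D' ≤ twinPairs D) := by
    intro D' hD'
    have := hmax D' hD'
    rwa [Prod.Lex.toLex_le_toLex] at this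
  refine ⟨D, ?_, hD, ?_⟩
  · have h1 : (fun x y => D₀ x y ∧ x ≠ y) ∈ X := by simp [X]
    have h2 : (copies s t D₀).card ≤ (copies s t (fun x y => D₀ x y ∧ x ≠ y)).card := by
      apply Finset.card_le_card
      intro S hS
      rw [mem_copies] at hS ⊢
      refine hS.congr ?_
      obtain ⟨-, A, -, -, h3⟩ := hS
      intro x hx y hy
      refine ⟨fun h => h.1, fun h => ⟨h, ?_⟩⟩
      rintro rfl
      have := (h3 x hx x hx).mp h
      exact this.2 this.1
    rcases hmax' _ h1 with h | h <;> omega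
  · intro u v h1 h2
    by_contra hT
    have key : ∀ u v, ¬ D u v → ¬ D v u → ¬ Twin D u v →
        (exclCopies s t D v u).card ≤ (exclCopies s t D u v).card ∧
        ((exclCopies s t D v u).card = (exclCopies s t D u v).card →
          (twinClass D v).card < (twinClass D u).card) := by
      intro u v h1 h2 hT
      have hc := clone_count s t D u v h1 h2
      have hm := hmax' (cloneD D u v) (fun x => hD _)
      refine ⟨by omega, fun heq => ?_⟩
      by_contra hle
      have := twinPairs_clone D u v hT (by omega)
      omega
    have k1 := key u v h1 h2 hT
    have k2 := key v u h2 h1 (fun h => hT h.symm)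
    have := k1.2 (by omega)
    have := k2.2 (by omega)
    omega

lemma good_count (s t : ℕ) (hs : 2 ≤ s) (hst : s ≤ t) {V : Type} [Fintype V] [DecidableEq V]
    (D : V → V → Prop) (hD : ∀ u v, ¬ D u v → ¬ D v u → Twin D u v) :
    ((copies s t D).card : ℝ) ≤ (((s : ℝ) / (s + t)) ^ s * ((t : ℝ) / (s + t)) ^ t *
      (Fintype.card V : ℝ) ^ (s + t)) / (s.factorial * t.factorial) := by
  classical
  let c : V → Finset V := twinClass D
  let fib : Finset V → Finset V := fun P => Finset.univ.filter (fun v => c v = P)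
  let R : Finset V → Finset V → Prop := fun P Q => ∃ u v, c u = P ∧ c v = Q ∧ D u v ∧ ¬ D v u
  have hc : ∀ u v, c u = c v → Twin D u v := by
    intro u v h
    have : v ∈ c u := by rw [h]; exact mem_twinClass.mpr (Twin.refl _ _)
    exact mem_twinClass.mp this
  have hc' : ∀ u v, Twin D u v → c u = c v := by
    intro u v h
    ext w
    simp only [c, mem_twinClass]
    exact ⟨fun h' => h.symm.trans h', fun h' => h.trans h'⟩
  have hR : ∀ P Q, R P Q → ¬ R Q P := by
    rintro P Q ⟨u, v, hu, hv, h1, h2⟩ ⟨v', u', hv', hu', h3, h4⟩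
    have a1 := hc u u' (hu.trans hu'.symm)
    have a2 := hc v v' (hv.trans hv'.symm)
    exact h4 ((a1 v').1.mp ((a2 u).2.mp h1))
  let T : Finset (Finset V × Finset V) := Finset.univ.filter (fun p => R p.1 p.2)
  have hsub : copies s t D ⊆ T.biUnion (fun p =>
      ((fib p.1).powersetCard s ×ˢ (fib p.2).powersetCard t).image (fun q => q.1 ∪ q.2)) := by
    intro S hS
    rw [mem_copies] at hS
    obtain ⟨hcard, A, hA, hAc, h3⟩ := hS
    have hBc : (S \ A).card = t := by rw [Finset.card_sdiff_of_subset hA]; omega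
    obtain ⟨a, ha⟩ := Finset.card_pos.mp (show 0 < A.card by omega)
    obtain ⟨b, hb⟩ := Finset.card_pos.mp (show 0 < (S \ A).card by omega)
    rw [Finset.mem_sdiff] at hb
    rw [Finset.mem_biUnion]
    refine ⟨(c a, c b), ?_, ?_⟩
    · simp only [T, Finset.mem_filter, Finset.mem_univ, true_and]
      refine ⟨a, b, rfl, rfl, (h3 a (hA ha) b hb.1).mpr ⟨ha, hb.2⟩, fun h => ?_⟩
      exact hb.2 ((h3 b hb.1 a (hA ha)).mp h).1
    · rw [Finset.mem_image]
      refine ⟨(A, S \ A), ?_, Finset.union_sdiff_of_subset hA⟩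
      rw [Finset.mem_product, Finset.mem_powersetCard, Finset.mem_powersetCard]
      refine ⟨⟨?_, hAc⟩, ?_, hBc⟩
      · intro x hx
        simp only [fib, Finset.mem_filter, Finset.mem_univ, true_and]
        apply hc'
        apply hD
        · exact fun h => ((h3 x (hA hx) a (hA ha)).mp h).2 ha
        · exact fun h => ((h3 a (hA ha) x (hA hx)).mp h).2 hx
      · intro x hx
        rw [Finset.mem_sdiff] at hx
        simp only [fib, Finset.mem_filter, Finset.mem_univ, true_and]
        apply hc'
        apply hD
        · exact fun h => hx.2 ((h3 x hx.1 b hb.1).mp h).1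
        · exact fun h => hb.2 ((h3 b hb.1 x hx.1).mp h).1
  have hle : (copies s t D).card ≤ ∑ p ∈ T, (fib p.1).card.choose s * (fib p.2).card.choose t := by
    refine (Finset.card_le_card hsub).trans (Finset.card_biUnion_le.trans ?_)
    refine Finset.sum_le_sum fun p _ => Finset.card_image_le.trans ?_
    rw [Finset.card_product, Finset.card_powersetCard, Finset.card_powersetCard]
  have hsum : ∑ P : Finset V, ((fib P).card : ℝ) = Fintype.card V := by
    rw [← Nat.cast_sum]
    congr 1
    have := Finset.card_eq_sum_card_fiberwise (f := c) (s := Finset.univ) (t := Finset.univ)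
      (by simp [Set.MapsTo])
    rw [← Finset.card_univ, this]
  have horient := orientedSum_le s t hs hst Finset.univ (fun P : Finset V => ((fib P).card : ℝ))
    (fun _ => by positivity) R hR
  rw [hsum] at horient
  rw [le_div_iff₀ (by positivity)]
  refine le_trans ?_ horient
  rw [← Finset.sum_product', Finset.univ_product_univ, ← Finset.sum_filter]
  have hle' : ((copies s t D).card : ℝ) ≤
      ∑ p ∈ T, ((fib p.1).card.choose s : ℝ) * ((fib p.2).card.choose t : ℝ) := by
    exact_mod_cast hle
  refine (mul_le_mul_of_nonneg_right hle' (by positivity)).trans ?_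
  rw [Finset.sum_mul]
  refine Finset.sum_le_sum fun p _ => ?_
  have b1 : ((fib p.1).card.choose s : ℝ) * s.factorial ≤ ((fib p.1).card : ℝ) ^ s := by
    rw [← le_div_iff₀ (by positivity)]
    exact Nat.choose_le_pow_div _ _
  have b2 : ((fib p.2).card.choose t : ℝ) * t.factorial ≤ ((fib p.2).card : ℝ) ^ t := by
    rw [← le_div_iff₀ (by positivity)]
    exact Nat.choose_le_pow_div _ _
  calc _ = (((fib p.1).card.choose s : ℝ) * s.factorial) *
        (((fib p.2).card.choose t : ℝ) * t.factorial) := by ring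
    _ ≤ _ := mul_le_mul b1 b2 (by positivity) (by positivity)

lemma extremal_bdd (s t n : ℕ) :
    BddAbove {m : ℕ | ∃ D : Fin n → Fin n → Prop, kstCount s t D = m} :=
  (Set.finite_range (fun D : Fin n → Fin n → Prop => kstCount s t D)).bddAbove

lemma extremal_upper (s t : ℕ) (hs : 2 ≤ s) (hst : s ≤ t) (n : ℕ) :
    (kstExtremal s t n : ℝ) ≤ (((s : ℝ) / (s + t)) ^ s * ((t : ℝ) / (s + t)) ^ t *
      (n : ℝ) ^ (s + t)) / (s.factorial * t.factorial) := by
  obtain ⟨D₀, h⟩ : kstExtremal s t n ∈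
      {m : ℕ | ∃ D : Fin n → Fin n → Prop, kstCount s t D = m} :=
    Nat.sSup_mem ⟨_, fun _ _ => False, rfl⟩ (extremal_bdd s t n)
  rw [← h, kstCount_eq]
  obtain ⟨D, h1, -, h2⟩ := exists_good s t D₀
  have h3 := good_count s t hs hst D h2
  rw [Fintype.card_fin] at h3
  exact le_trans (by exact_mod_cast h1) h3

lemma extremal_lower (s t n a : ℕ) (ha : a ≤ n) :
    a.choose s * (n - a).choose t ≤ kstExtremal s t n := by
  classical
  let P : Finset (Fin n) := Finset.univ.filter (fun i => (i : ℕ) < a)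
  have hP : P.card = a := by
    rw [Fin.card_filter_val_lt]; omega
  have hPc : Pᶜ.card = n - a := by rw [Finset.card_compl, hP, Fintype.card_fin]
  let D : Fin n → Fin n → Prop := fun u w => u ∈ P ∧ w ∉ P
  have h1 : kstCount s t D ≤ kstExtremal s t n := le_csSup (extremal_bdd s t n) ⟨D, rfl⟩
  refine le_trans ?_ h1
  rw [kstCount_eq, ← hP, ← Finset.card_powersetCard, hP, ← hPc, ← Finset.card_powersetCard,
    ← Finset.card_product]
  have hmem : ∀ q ∈ P.powersetCard s ×ˢ Pᶜ.powersetCard t, (q.1 ∪ q.2) ∩ P = q.1 ∧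
      (q.1 ∪ q.2) \ P = q.2 ∧ q.1.card = s ∧ q.2.card = t := by
    rintro ⟨A, B⟩ hq
    simp only [Finset.mem_product, Finset.mem_powersetCard] at hq
    obtain ⟨⟨hA, hAc⟩, hB, hBc⟩ := hq
    have hA' : ∀ x ∈ A, x ∈ P := fun x hx => hA hx
    have hB' : ∀ x ∈ B, x ∉ P := fun x hx => Finset.mem_compl.mp (hB hx)
    refine ⟨?_, ?_, hAc, hBc⟩
    · ext x
      have := hA' x
      have := hB' x
      simp only [Finset.mem_inter, Finset.mem_union]
      tauto
    · ext x
      have := hA' x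
      have := hB' x
      simp only [Finset.mem_sdiff, Finset.mem_union]
      tauto
  apply Finset.card_le_card_of_injOn (fun q => q.1 ∪ q.2)
  · intro q hq
    obtain ⟨e1, e2, e3, e4⟩ := hmem q hq
    simp only [Finset.mem_coe, mem_copies]
    refine ⟨?_, q.1, Finset.subset_union_left, e3, ?_⟩
    · rw [← Finset.card_inter_add_card_sdiff (q.1 ∪ q.2) P, e1, e2, e3, e4]
    · intro u hu w hw
      have key : ∀ z ∈ q.1 ∪ q.2, (z ∈ P ↔ z ∈ q.1) := by
        intro z hz
        rw [← e1, Finset.mem_inter]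
        tauto
      simp only [D]
      rw [key u hu, key w hw]
  · intro q hq q' hq' heq
    obtain ⟨e1, e2, -, -⟩ := hmem q hq
    obtain ⟨e1', e2', -, -⟩ := hmem q' hq'
    simp only at heq
    rw [heq] at e1 e2
    exact Prod.ext (e1.symm.trans e1') (e2.symm.trans e2')

open Filter Topology

lemma choose_div_pow (k : ℕ) :
    Tendsto (fun n : ℕ => (n.choose k : ℝ) / (n : ℝ) ^ k) atTop (𝓝 (1 / k.factorial)) := by
  have h := (isEquivalent_choose k)
  have h2 : Tendsto (fun n : ℕ => ((n : ℝ) ^ k / k.factorial) / (n : ℝ) ^ k) atTop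
      (𝓝 (1 / k.factorial)) := by
    apply tendsto_const_nhds.congr'
    filter_upwards [eventually_gt_atTop 0] with n hn
    have : (0 : ℝ) < n := by exact_mod_cast hn
    field_simp
  exact (h.div (Asymptotics.IsEquivalent.refl (u := fun n : ℕ => (n : ℝ) ^ k))).symm.tendsto_nhds h2

lemma choose_seq (k : ℕ) (a : ℕ → ℕ) (r : ℝ) (hr : 0 < r)
    (ha : Tendsto (fun n : ℕ => (a n : ℝ) / n) atTop (𝓝 r)) :
    Tendsto (fun n : ℕ => ((a n).choose k : ℝ) / (n : ℝ) ^ k) atTop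
      (𝓝 (1 / k.factorial * r ^ k)) := by
  have h1 : Tendsto (fun n : ℕ => (a n : ℝ)) atTop atTop := by
    have := ha.pos_mul_atTop hr tendsto_natCast_atTop_atTop
    apply this.congr'
    filter_upwards [eventually_gt_atTop 0] with n hn
    have : (0 : ℝ) < n := by exact_mod_cast hn
    field_simp
  have h2 : Tendsto a atTop atTop := tendsto_natCast_atTop_iff.mp h1
  have h3 := ((choose_div_pow k).comp h2).mul (ha.pow k)
  apply h3.congr'
  filter_upwards [eventually_gt_atTop 0, h2.eventually_gt_atTop 0] with n hn han
  have : (0 : ℝ) < n := by exact_mod_cast hn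
  have : (0 : ℝ) < a n := by exact_mod_cast han
  simp only [Function.comp]
  rw [div_pow]
  field_simp

theorem kst_inducibility_limit (s t : ℕ) (hs : 2 ≤ s) (hst : s ≤ t) :
    Filter.Tendsto (fun n : ℕ => (kstExtremal s t n : ℝ) / (n.choose (s + t) : ℝ))
      Filter.atTop
      (nhds (((s + t).choose s : ℝ) * ((s : ℝ) / (s + t)) ^ s * ((t : ℝ) / (s + t)) ^ t)) := by
  have hs' : (0 : ℝ) < s := by exact_mod_cast (show 0 < s by omega)
  have ht' : (0 : ℝ) < t := by exact_mod_cast (show 0 < t by omega)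
  have hfac : ((s + t).choose s : ℝ) = (s + t).factorial / (s.factorial * t.factorial) := by
    exact Nat.cast_add_choose ℝ
  set r : ℝ := (s : ℝ) / (s + t) with hr
  set q : ℝ := (t : ℝ) / (s + t) with hq
  have hr0 : 0 < r := by positivity
  have hq0 : 0 < q := by positivity
  have hrq : r + q = 1 := by rw [hr, hq]; field_simp
  have hch := choose_div_pow (s + t)
  have hne : (1 / ((s + t).factorial : ℝ)) ≠ 0 := by positivity
  -- the part sizes of the bipartite construction
  let a : ℕ → ℕ := fun n => ⌊r * n⌋₊
  have han : ∀ n, a n ≤ n := by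
    intro n
    apply Nat.floor_le_of_le
    have : (0 : ℝ) ≤ n := by positivity
    nlinarith
  have ha : Tendsto (fun n : ℕ => (a n : ℝ) / n) atTop (𝓝 r) :=
    (tendsto_nat_floor_mul_div_atTop hr0.le).comp tendsto_natCast_atTop_atTop
  have hb : Tendsto (fun n : ℕ => ((n - a n : ℕ) : ℝ) / n) atTop (𝓝 q) := by
    have : Tendsto (fun n : ℕ => 1 - (a n : ℝ) / n) atTop (𝓝 (1 - r)) :=
      tendsto_const_nhds.sub ha
    rw [show q = 1 - r by linarith]
    apply this.congr'
    filter_upwards [eventually_gt_atTop 0] with n hn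
    have : (0 : ℝ) < n := by exact_mod_cast hn
    rw [Nat.cast_sub (han n)]
    field_simp
  have hlow := ((choose_seq s a r hr0 ha).mul (choose_seq t _ q hq0 hb)).div hch hne
  have hup : Tendsto (fun n : ℕ => (r ^ s * q ^ t / (s.factorial * t.factorial)) /
      ((n.choose (s + t) : ℝ) / (n : ℝ) ^ (s + t))) atTop
      (𝓝 ((r ^ s * q ^ t / (s.factorial * t.factorial)) / (1 / (s + t).factorial))) :=
    tendsto_const_nhds.div hch hne
  have e1 : (1 / s.factorial * r ^ s * (1 / t.factorial * q ^ t)) / (1 / ((s + t).factorial : ℝ))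
      = ((s + t).choose s : ℝ) * r ^ s * q ^ t := by
    rw [hfac]; field_simp
  have e2 : (r ^ s * q ^ t / (s.factorial * t.factorial)) / (1 / ((s + t).factorial : ℝ))
      = ((s + t).choose s : ℝ) * r ^ s * q ^ t := by
    rw [hfac]; field_simp
  rw [e1] at hlow
  rw [e2] at hup
  refine tendsto_of_tendsto_of_tendsto_of_le_of_le' hlow hup ?_ ?_
  · filter_upwards [eventually_ge_atTop (s + t)] with n hn
    have hn0 : (0 : ℝ) < n := by exact_mod_cast (show 0 < n by omega)
    have hC : (0 : ℝ) < n.choose (s + t) := by exact_mod_cast Nat.choose_pos hn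
    have h : ((a n).choose s : ℝ) * ((n - a n).choose t : ℝ) ≤ kstExtremal s t n := by
      exact_mod_cast extremal_lower s t n (a n) (han n)
    calc _ = ((a n).choose s : ℝ) * ((n - a n).choose t : ℝ) / n.choose (s + t) := by
          simp only [Pi.div_apply]
          rw [pow_add]; field_simp
      _ ≤ _ := by gcongr
  · filter_upwards [eventually_ge_atTop (s + t)] with n hn
    have hn0 : (0 : ℝ) < n := by exact_mod_cast (show 0 < n by omega)
    have hC : (0 : ℝ) < n.choose (s + t) := by exact_mod_cast Nat.choose_pos hn
    have h := extremal_upper s t hs hst n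
    calc _ ≤ (r ^ s * q ^ t * (n : ℝ) ^ (s + t)) / (s.factorial * t.factorial) /
          (n.choose (s + t) : ℝ) := by gcongr
      _ = _ := by field_simp
end
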